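/- Let K be a field of characteristic p > 0, ω ∈ Ω^r_{K(z)/K} a rational r-form, and η_1,…,η_r ∈ Ω^1_{K(z)/K} closed 1-forms (dη_i = 0) with ω∧η_i = 0 for every i, which are linearly independent over K(z^p). If η_1∧…∧η_r = 0, then ω has a rational first integral. -/

import Mathlib

/- Framework: rational function field `K(z) = K(z₁,…,zₙ)`, its subfield `K(zᵖ)` of
∂-constants, and rational differential forms modelled as the exterior algebra over `K(z)`
on the free module with basis `dz₁,…,dzₙ` (canonically isomorphic to the exterior powers
of the Kähler differentials `Ω¹_{K(z)/K}`); the wedge product is the algebra product. -/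

set_option synthInstance.maxHeartbeats 1000000
set_option maxHeartbeats 4000000

noncomputable section
open MvPolynomial

/-- The field of rational functions `K(z₁,…,zₙ)`. -/
abbrev Kz (K : Type) [Field K] (n : ℕ) := FractionRing (MvPolynomial (Fin n) K)

variable (K : Type) [Field K] (n : ℕ)

/-- The inclusion of polynomials into rational functions. -/
def toKz : MvPolynomial (Fin n) K →+* Kz K n := algebraMap _ _

/-- Rational differential forms on `Kⁿ`. -/
abbrev Forms (K : Type) [Field K] (n : ℕ) := ExteriorAlgebra (Kz K n) (Fin n → Kz K n)

/-- The 1-form `dz i`. -/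
def dz (i : Fin n) : Forms K n := ExteriorAlgebra.ι (Kz K n) (Pi.single i 1)

/-- The 1-form with coordinates `v` with respect to the basis `dz₁,…,dzₙ`. -/
def oneForm (v : Fin n → Kz K n) : Forms K n := ExteriorAlgebra.ι (Kz K n) v

/-- The `r`-form `dz_{s 0} ∧ ⋯ ∧ dz_{s (r-1)}`. -/
def dzP (r : ℕ) (s : Fin r → Fin n) : Forms K n := (List.ofFn fun i => dz K n (s i)).prod

/-- The partial derivative `∂/∂zᵢ`, extended from `K[z]` to `K(z)` by the quotient rule
(applied to a chosen fraction representation; the value does not depend on the choice). -/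
def pd (i : Fin n) (f : Kz K n) : Kz K n :=
  let a := (IsLocalization.sec (nonZeroDivisors (MvPolynomial (Fin n) K)) f).1
  let b := ((IsLocalization.sec (nonZeroDivisors (MvPolynomial (Fin n) K)) f).2 :
      MvPolynomial (Fin n) K)
  (toKz K n (pderiv i a) * toKz K n b - toKz K n a * toKz K n (pderiv i b)) / (toKz K n b) ^ 2

/-- The differential `df = ∑ᵢ (∂f/∂zᵢ) dzᵢ` of a rational function `f`. -/
def dd (f : Kz K n) : Forms K n := ∑ i, pd K n i f • dz K n i

/-- The `r`-form with (rational) coefficients `c`. -/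
def formOf (r : ℕ) (c : (Fin r → Fin n) → Kz K n) : Forms K n := ∑ s, c s • dzP K n r s

/-- The exterior derivative of the `r`-form with coefficients `c`:
`d(∑ c_s dz_s) = ∑ (d c_s) ∧ dz_s`. -/
def Dform (r : ℕ) (c : (Fin r → Fin n) → Kz K n) : Forms K n := ∑ s, dd K n (c s) * dzP K n r s

/-- The polynomial `r`-form with polynomial coefficients `c`. -/
def polyFormOf (r : ℕ) (c : (Fin r → Fin n) → MvPolynomial (Fin n) K) : Forms K n :=
  formOf K n r fun s => toKz K n (c s)

/-- The exterior derivative of the polynomial `r`-form with coefficients `c`. -/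
def Dpoly (r : ℕ) (c : (Fin r → Fin n) → MvPolynomial (Fin n) K) : Forms K n :=
  Dform K n r fun s => toKz K n (c s)

/-- The exterior derivative of the 1-form with coordinates `v`. -/
def d1 (v : Fin n → Kz K n) : Forms K n := ∑ j, dd K n (v j) * dz K n j

/-- The subfield `K(zᵖ) = K(z₁ᵖ,…,zₙᵖ) ⊆ K(z)` of ∂-constants. -/
def pConsts (p : ℕ) : Subfield (Kz K n) :=
  Subfield.closure (Set.range (algebraMap K (Kz K n)) ∪
    Set.range fun i : Fin n => (toKz K n (X i)) ^ p)

/-- `F` is invariant by the `r`-form `ω`: `dF ≠ 0` and `F` divides `ω ∧ dF`,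
the quotient being a polynomial `(r+1)`-form (the cofactor `Θ_F`). -/
def FormInvariant (r : ℕ) (ω : Forms K n) (F : MvPolynomial (Fin n) K) : Prop :=
  dd K n (toKz K n F) ≠ 0 ∧
    ∃ Θ : (Fin (r + 1) → Fin n) → MvPolynomial (Fin n) K,
      ω * dd K n (toKz K n F) = toKz K n F • polyFormOf K n (r + 1) Θ

/-- `f` is a rational first integral of the form `ω`: `df ≠ 0` and `ω ∧ df = 0`. -/
def IsFirstIntegral (ω : Forms K n) (f : Kz K n) : Prop :=
  dd K n f ≠ 0 ∧ ω * dd K n f = 0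

/-- The `K(zᵖ)`-subspace `Ω^r_{L_d/K(zᵖ)}` spanned by the forms
`z^I · dz_{s 0} ∧ ⋯ ∧ dz_{s (r-1)}` with `0 ≤ I j ≤ p−1` and `∑ I ≤ d`. -/
def Lforms (p d r : ℕ) : Submodule (pConsts K n p) (Forms K n) :=
  Submodule.span (pConsts K n p)
    { x | ∃ (I : Fin n → ℕ) (s : Fin r → Fin n), (∀ j, I j ≤ p - 1) ∧ (∑ j, I j ≤ d) ∧
        x = toKz K n (∏ j, X j ^ I j) • dzP K n r s }

/-- `N_K(n,d,r) = dim_{K(zᵖ)} Ω^r_{L_d/K(zᵖ)}`. -/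
def NK (p d r : ℕ) : ℕ := Module.finrank (pConsts K n p) (Lforms K n p d r)

/-- The submodule of `r`-forms (the `r`-th exterior power of the module of 1-forms). -/
def gradeR (r : ℕ) : Submodule (Kz K n) (Forms K n) :=
  (LinearMap.range (ExteriorAlgebra.ι (Kz K n) :
      (Fin n → Kz K n) →ₗ[Kz K n] Forms K n)) ^ r

section PartialDerivatives

variable {K n}

lemma toKz_injective : Function.Injective (toKz K n) :=
  IsFractionRing.injective (MvPolynomial (Fin n) K) (Kz K n)

lemma toKz_ne_zero {b : MvPolynomial (Fin n) K} (hb : b ≠ 0) : toKz K n b ≠ 0 :=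
  (map_ne_zero_iff _ toKz_injective).2 hb

lemma exists_mul_toKz_eq (f : Kz K n) :
    ∃ a b : MvPolynomial (Fin n) K, b ≠ 0 ∧ f * toKz K n b = toKz K n a := by
  refine ⟨_, _, ?_, IsLocalization.sec_spec (nonZeroDivisors (MvPolynomial (Fin n) K)) f⟩
  exact nonZeroDivisors.ne_zero (SetLike.coe_mem _)

/-- Leibniz rule characterising the partial derivative of a fraction. -/
lemma pd_mul_toKz (i : Fin n) {f : Kz K n} {a b : MvPolynomial (Fin n) K} (hb : b ≠ 0)
    (h : f * toKz K n b = toKz K n a) :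
    pd K n i f * toKz K n b + f * toKz K n (pderiv i b) = toKz K n (pderiv i a) := by
  have hs := IsLocalization.sec_spec (nonZeroDivisors (MvPolynomial (Fin n) K)) f
  have hne : ((IsLocalization.sec (nonZeroDivisors (MvPolynomial (Fin n) K)) f).2 :
      MvPolynomial (Fin n) K) ≠ 0 := nonZeroDivisors.ne_zero (SetLike.coe_mem _)
  unfold pd
  generalize (IsLocalization.sec (nonZeroDivisors (MvPolynomial (Fin n) K)) f).1 = a' at *
  generalize ((IsLocalization.sec (nonZeroDivisors (MvPolynomial (Fin n) K)) f).2 :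
      MvPolynomial (Fin n) K) = b' at *
  change f * toKz K n b' = toKz K n a' at hs
  have hB := toKz_ne_zero hb
  have hB' := toKz_ne_zero hne
  have cross : a * b' = a' * b := toKz_injective (by
    rw [map_mul, map_mul, ← h, ← hs]; ring)
  have der := congrArg (fun q => toKz K n (pderiv i q)) cross
  simp only [pderiv_mul, map_add, map_mul] at der
  have key : (toKz K n (pderiv i a') * toKz K n b' - toKz K n a' * toKz K n (pderiv i b')) *
      toKz K n b + f * toKz K n (pderiv i b) * toKz K n b' ^ 2 =
      toKz K n (pderiv i a) * toKz K n b' ^ 2 := by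
    rw [← h, ← hs] at der
    rw [← hs]
    linear_combination (-toKz K n b') * der
  dsimp only
  field_simp
  linear_combination key

lemma pd_add (i : Fin n) (f g : Kz K n) : pd K n i (f + g) = pd K n i f + pd K n i g := by
  obtain ⟨a, b, hb, hf⟩ := exists_mul_toKz_eq f
  obtain ⟨c, d, hd, hg⟩ := exists_mul_toKz_eq g
  have hfg : (f + g) * toKz K n (b * d) = toKz K n (a * d + c * b) := by
    simp only [map_mul, map_add, ← hf, ← hg]; ring
  have h := pd_mul_toKz i (mul_ne_zero hb hd) hfg
  have h1 := pd_mul_toKz i hb hf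
  have h2 := pd_mul_toKz i hd hg
  simp only [pderiv_mul, map_add, map_mul, ← hf, ← hg, ← h1, ← h2] at h
  apply mul_right_cancel₀ (mul_ne_zero (toKz_ne_zero hb) (toKz_ne_zero hd))
  linear_combination h

lemma pd_mul (i : Fin n) (f g : Kz K n) :
    pd K n i (f * g) = f * pd K n i g + g * pd K n i f := by
  obtain ⟨a, b, hb, hf⟩ := exists_mul_toKz_eq f
  obtain ⟨c, d, hd, hg⟩ := exists_mul_toKz_eq g
  have hfg : (f * g) * toKz K n (b * d) = toKz K n (a * c) := by
    simp only [map_mul, ← hf, ← hg]; ring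
  have h := pd_mul_toKz i (mul_ne_zero hb hd) hfg
  have h1 := pd_mul_toKz i hb hf
  have h2 := pd_mul_toKz i hd hg
  simp only [pderiv_mul, map_add, map_mul, ← hf, ← hg, ← h1, ← h2] at h
  apply mul_right_cancel₀ (mul_ne_zero (toKz_ne_zero hb) (toKz_ne_zero hd))
  linear_combination h

end PartialDerivatives

section Constants

variable {K n}

lemma toKz_monomial_mem_pConsts (p : ℕ) (m : Fin n →₀ ℕ) (hm : ∀ i, p ∣ m i) (c : K) :
    toKz K n (monomial m c) ∈ pConsts K n p := by
  have hC : toKz K n (C c) = algebraMap K (Kz K n) c :=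
    (IsScalarTower.algebraMap_apply K (MvPolynomial (Fin n) K) (Kz K n) c).symm
  rw [monomial_eq, map_mul, hC, Finsupp.prod, map_prod]
  refine mul_mem (Subfield.subset_closure (Or.inl ⟨c, rfl⟩)) (prod_mem fun i _ => ?_)
  obtain ⟨k, hk⟩ := hm i
  rw [hk, map_pow, pow_mul]
  have hX : toKz K n (X i) ^ p ∈ pConsts K n p := Subfield.subset_closure (Or.inr ⟨i, rfl⟩)
  exact pow_mem hX k

lemma toKz_mem_pConsts_of_pderiv_eq_zero (p : ℕ) [CharP K p]
    {q : MvPolynomial (Fin n) K} (hq : ∀ i, pderiv i q = 0) : toKz K n q ∈ pConsts K n p := by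
  rw [q.as_sum, map_sum]
  refine sum_mem fun m hm => toKz_monomial_mem_pConsts p m (fun i => ?_) _
  by_contra hdvd
  have hmi : m i ≠ 0 := fun h => hdvd (h ▸ dvd_zero p)
  have hc := coeff_pderiv (i := i) q (m - Finsupp.single i 1)
  have hle : Finsupp.single i 1 ≤ m := by
    rw [Finsupp.single_le_iff]; omega
  rw [hq i, coeff_zero, tsub_add_cancel_of_le hle] at hc
  have hcast : (((m - Finsupp.single i 1 : Fin n →₀ ℕ) i : ℕ) : K) + 1 = (m i : ℕ) := by
    rw [← Nat.cast_add_one]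
    congr 1
    simp
    omega
  rw [hcast] at hc
  rcases mul_eq_zero.1 hc.symm with h | h
  · exact mem_support_iff.1 hm h
  · exact hdvd ((CharP.cast_eq_zero_iff K p _).1 h)

/-- In characteristic `p` the common kernel of the partial derivatives is `K(zᵖ)`. -/
lemma mem_pConsts_of_pd_eq_zero (p : ℕ) (hp : p.Prime) [CharP K p] {f : Kz K n}
    (hf : ∀ i, pd K n i f = 0) : f ∈ pConsts K n p := by
  obtain ⟨a, b, hb, hab⟩ := exists_mul_toKz_eq f
  have hbp : ∀ i, pderiv i (b ^ p) = 0 := fun i => by simp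
  have hmul : f * toKz K n (b ^ p) = toKz K n (a * b ^ (p - 1)) := by
    rw [map_mul, ← hab, mul_assoc, ← map_mul, mul_pow_sub_one hp.ne_zero]
  have ha : ∀ i, pderiv i (a * b ^ (p - 1)) = 0 := fun i => toKz_injective (by
    rw [← pd_mul_toKz i (pow_ne_zero p hb) hmul, hf i, hbp i]; simp)
  rw [eq_div_of_mul_eq (toKz_ne_zero (pow_ne_zero p hb)) hmul]
  exact div_mem (toKz_mem_pConsts_of_pderiv_eq_zero p ha)
    (toKz_mem_pConsts_of_pderiv_eq_zero p hbp)

end Constants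

section OneForms

variable {K n}

lemma oneForm_eq_sum (v : Fin n → Kz K n) : oneForm K n v = ∑ j, v j • dz K n j := by
  conv_lhs => rw [oneForm, pi_eq_sum_univ' v, map_sum]
  refine Finset.sum_congr rfl fun i _ => ?_
  rw [map_smul, dz]

lemma dd_eq_oneForm (f : Kz K n) : dd K n f = oneForm K n fun i => pd K n i f :=
  (oneForm_eq_sum _).symm

lemma pd_eq_zero_of_dd_eq_zero {f : Kz K n} (h : dd K n f = 0) (i : Fin n) :
    pd K n i f = 0 := by
  rw [dd_eq_oneForm, oneForm, ExteriorAlgebra.ι_eq_zero_iff] at h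
  exact congrFun h i

lemma dd_add (f g : Kz K n) : dd K n (f + g) = dd K n f + dd K n g := by
  simp only [dd, pd_add, add_smul, Finset.sum_add_distrib]

lemma dd_mul (f g : Kz K n) : dd K n (f * g) = f • dd K n g + g • dd K n f := by
  simp only [dd, pd_mul, add_smul, mul_smul, Finset.sum_add_distrib, Finset.smul_sum]

lemma d1_add (v w : Fin n → Kz K n) : d1 K n (v + w) = d1 K n v + d1 K n w := by
  simp only [d1, Pi.add_apply, dd_add, add_mul, Finset.sum_add_distrib]

lemma d1_sum {κ : Type*} (s : Finset κ) (v : κ → Fin n → Kz K n) :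
    d1 K n (∑ k ∈ s, v k) = ∑ k ∈ s, d1 K n (v k) :=
  map_sum (AddMonoidHom.mk' (d1 K n) d1_add) v s

lemma d1_smul (a : Kz K n) (v : Fin n → Kz K n) :
    d1 K n (a • v) = a • d1 K n v + dd K n a * oneForm K n v := by
  simp only [d1, oneForm_eq_sum, Pi.smul_apply, smul_eq_mul, dd_mul, add_mul,
    Finset.sum_add_distrib, Finset.smul_sum, Finset.mul_sum, smul_mul_assoc, mul_smul_comm]

end OneForms

section Exterior

variable {F V : Type*} [Field F] [AddCommGroup V] [Module F V]

lemma exists_dual_family {κ : Type*} [DecidableEq κ] {v : κ → V} (hv : LinearIndependent F v) :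
    ∃ φ : κ → Module.Dual F V, ∀ k l, φ k (v l) = if k = l then 1 else 0 := by
  obtain ⟨g, hg⟩ := LinearMap.exists_leftInverse_of_injective
    (Finsupp.linearCombination F v) (LinearMap.ker_eq_bot.2 hv)
  refine ⟨fun k => Finsupp.lapply k ∘ₗ g, fun k l => ?_⟩
  have h := LinearMap.congr_fun hg (Finsupp.single l 1)
  simp only [LinearMap.comp_apply, Finsupp.linearCombination_single, one_smul,
    LinearMap.id_apply] at h
  simp [h, Finsupp.single_apply, eq_comm]

lemma prod_ι_ne_zero {r : ℕ} {v : Fin r → V} (hv : LinearIndependent F v) :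
    (List.ofFn fun i => ExteriorAlgebra.ι F (v i)).prod ≠ 0 := by
  intro h
  obtain ⟨φ, hφ⟩ := exists_dual_family hv
  rw [← ExteriorAlgebra.ιMulti_apply] at h
  have h' := congrArg (ExteriorAlgebra.liftAlternating (R := F) (M := V)
    (Pi.single r ((Matrix.detRowAlternating (n := Fin r) (R := F)).compLinearMap
      (LinearMap.pi φ)))) h
  rw [ExteriorAlgebra.liftAlternating_apply_ιMulti, map_zero, Pi.single_eq_same] at h'
  have hone : (fun i => LinearMap.pi φ (v i)) = (1 : Matrix (Fin r) (Fin r) F) := by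
    ext i j
    simp [hφ, Matrix.one_apply, eq_comm]
  change Matrix.det (fun i => LinearMap.pi φ (v i)) = 0 at h'
  rw [hone, Matrix.det_one] at h'
  exact one_ne_zero h'

/-- Cartan's lemma: if `∑ uₖ ∧ vₖ = 0` with the `vₖ` linearly independent, then every `uₖ` is a
linear combination of the `vₖ`. -/
lemma mem_span_of_sum_ι_mul_ι_eq_zero {κ : Type*} [Fintype κ] {u v : κ → V}
    (hv : LinearIndependent F v)
    (h : ∑ k, ExteriorAlgebra.ι F (u k) * ExteriorAlgebra.ι F (v k) = 0) (m : κ) :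
    u m ∈ Submodule.span F (Set.range v) := by
  classical
  obtain ⟨φ, hφ⟩ := exists_dual_family hv
  have h' := congrArg (CliffordAlgebra.contractLeft (Q := (0 : QuadraticForm F V)) (φ m)) h
  have hterm : ∀ k, CliffordAlgebra.contractLeft (Q := (0 : QuadraticForm F V)) (φ m)
      (ExteriorAlgebra.ι F (u k) * ExteriorAlgebra.ι F (v k)) =
      ExteriorAlgebra.ι F (φ m (u k) • v k - (if m = k then (1 : F) else 0) • u k) := by
    intro k
    rw [map_sub, map_smul, map_smul, ← hφ m k]
    refine (CliffordAlgebra.contractLeft_ι_mul (φ m) (u k) _).trans ?_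
    congr 1
    refine (congrArg _ (CliffordAlgebra.contractLeft_ι (0 : QuadraticForm F V) (φ m) (v k))).trans ?_
    rw [← Algebra.commutes, ← Algebra.smul_def]
  rw [map_sum, map_zero, Finset.sum_congr rfl fun k _ => hterm k, ← map_sum,
    ExteriorAlgebra.ι_eq_zero_iff, Finset.sum_sub_distrib, sub_eq_zero] at h'
  simp only [ite_smul, one_smul, zero_smul, Finset.sum_ite_eq, Finset.mem_univ, if_true] at h'
  rw [← h']
  exact Submodule.sum_mem _ fun k _ =>
    Submodule.smul_mem _ _ (Submodule.subset_span (Set.mem_range_self k))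

end Exterior

/-- Let `K` have characteristic `p > 0`, let `ω` be a rational `r`-form and let
`η₁,…,η_r` be closed tangent 1-forms of `ω` which are linearly independent over `K(zᵖ)`.
If `η₁ ∧ ⋯ ∧ η_r = 0`, then `ω` has a rational first integral. -/
theorem statement9 (p : ℕ) (hp : p.Prime) [CharP K p] (r : ℕ)
    (ω : Forms K n) (hω : ω ∈ gradeR K n r)
    (η : Fin r → (Fin n → Kz K n))
    (hclosed : ∀ i, d1 K n (η i) = 0)
    (htan : ∀ i, ω * oneForm K n (η i) = 0)
    (hli : LinearIndependent (pConsts K n p) fun i => oneForm K n (η i))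
    (hw : (List.ofFn fun i => oneForm K n (η i)).prod = 0) :
    ∃ f : Kz K n, IsFirstIntegral K n ω f := by
  classical
  by_contra! hno
  have hdep : ¬ LinearIndependent (Kz K n) η := fun h => prod_ι_ne_zero h hw
  obtain ⟨κ, e, he, hspan, hind⟩ := exists_linearIndependent' (Kz K n) η
  have : Finite κ := Finite.of_injective e he
  have : Fintype κ := Fintype.ofFinite κ
  obtain ⟨i₀, hi₀⟩ : ∃ i₀, i₀ ∉ Set.range e := by
    by_contra! hsurj
    exact hdep ((linearIndependent_equiv (Equiv.ofBijective e ⟨he, hsurj⟩)).1 hind)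
  obtain ⟨a, ha⟩ := (Submodule.mem_span_range_iff_exists_fun (Kz K n)).1
    (hspan ▸ Submodule.subset_span (Set.mem_range_self i₀) :
      η i₀ ∈ Submodule.span (Kz K n) (Set.range (η ∘ e)))
  have hd : ∑ k, dd K n (a k) * oneForm K n (η (e k)) = 0 := by
    have h := hclosed i₀
    rw [← ha, d1_sum] at h
    simpa [d1_smul, hclosed] using h
  simp only [dd_eq_oneForm] at hd
  have hconst (k : κ) : a k ∈ pConsts K n p := by
    refine mem_pConsts_of_pd_eq_zero p hp (pd_eq_zero_of_dd_eq_zero ?_)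
    by_contra hne
    refine hno (a k) ⟨hne, ?_⟩
    have hmem := mem_span_of_sum_ι_mul_ι_eq_zero hind hd k
    have hle : Submodule.span (Kz K n) (Set.range (η ∘ e)) ≤
        LinearMap.ker (LinearMap.mulLeft (Kz K n) ω ∘ₗ ExteriorAlgebra.ι (Kz K n)) := by
      rw [Submodule.span_le]
      rintro _ ⟨k, rfl⟩
      exact htan (e k)
    rw [dd_eq_oneForm]
    exact hle hmem
  refine hli.notMem_span_image (s := Set.range e) (x := i₀) hi₀ ?_
  have hsum : oneForm K n (η i₀) =
      ∑ k, (⟨a k, hconst k⟩ : pConsts K n p) • oneForm K n (η (e k)) := by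
    rw [← ha, oneForm, map_sum]
    exact Finset.sum_congr rfl fun k _ => map_smul _ _ _
  change oneForm K n (η i₀) ∈ _
  rw [hsum]
  exact Submodule.sum_mem _ fun k _ => Submodule.smul_mem _ _
    (Submodule.subset_span ⟨e k, Set.mem_range_self k, rfl⟩)
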